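/- Let X, Y be random variables and let U = φ(X), V = ψ(Y) be measurable functions of X and Y respectively, each marginally standard normal with correlation ρ = E[UV]. Then I(X;Y) ≥ I(U;V) ≥ −(1/2) log(1 − ρ²). -/

import Mathlib

open MeasureTheory ProbabilityTheory

/-- Kullback–Leibler divergence `D(μ‖ν) = ∫ log(dμ/dν) dμ`. -/
noncomputable def klDiv {E : Type*} [MeasurableSpace E] (μ ν : Measure E) : ℝ :=
  ∫ x, Real.log ((μ.rnDeriv ν x).toReal) ∂μ

/-- Mutual information of two random variables, as the KL divergence between the joint law
and the product of the marginal laws. -/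
noncomputable def mutualInfo {Ω : Type*} [MeasureSpace Ω] {α β : Type*}
    [MeasurableSpace α] [MeasurableSpace β] (X : Ω → α) (Y : Ω → β) : ℝ :=
  klDiv (Measure.map (fun ω => (X ω, Y ω)) (ℙ : Measure Ω))
    ((Measure.map X (ℙ : Measure Ω)).prod (Measure.map Y (ℙ : Measure Ω)))

/-- Log-density of the correlated Gaussian with respect to the product of the marginals. -/
noncomputable def gaussLogRatio (ρ : ℝ) (p : ℝ × ℝ) : ℝ :=
  -(1/2) * Real.log (1 - ρ^2)
    - (ρ^2 * p.1^2 - 2 * ρ * (p.1 * p.2) + ρ^2 * p.2^2) / (2 * (1 - ρ^2))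

lemma measurable_gaussLogRatio (ρ : ℝ) : Measurable (gaussLogRatio ρ) := by
  unfold gaussLogRatio
  fun_prop

lemma pdf_mul_exp_gaussLogRatio (ρ : ℝ) (h : 0 < 1 - ρ^2) (u v : ℝ) :
    gaussianPDFReal 0 1 v * Real.exp (gaussLogRatio ρ (u, v))
      = gaussianPDFReal (ρ * u) (Real.toNNReal (1 - ρ^2)) v := by
  have hs : Real.exp (-(1/2) * Real.log (1 - ρ^2)) = (Real.sqrt (1 - ρ^2))⁻¹ := by
    rw [Real.sqrt_eq_rpow, ← Real.rpow_neg h.le, Real.rpow_def_of_pos h]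
    ring_nf
  simp only [gaussianPDFReal, gaussLogRatio, Real.coe_toNNReal _ h.le]
  rw [sub_eq_add_neg (-(1/2) * Real.log (1 - ρ^2)), Real.exp_add, hs,
    Real.sqrt_mul (by positivity) (1 - ρ^2), mul_inv]
  have : Real.exp (-(v - ρ * u) ^ 2 / (2 * (1 - ρ ^ 2)))
      = Real.exp (-(v - 0) ^ 2 / (2 * ((1 : NNReal) : ℝ))) *
        Real.exp (-((ρ^2 * u^2 - 2 * ρ * (u * v) + ρ^2 * v^2) / (2 * (1 - ρ^2)))) := by
    rw [← Real.exp_add]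
    congr 1
    push_cast
    field_simp
    ring
  rw [this]
  simp only [NNReal.coe_one, mul_one]
  ring

lemma lintegral_exp_gaussLogRatio (ρ : ℝ) (h : 0 < 1 - ρ^2) :
    ∫⁻ p, ENNReal.ofReal (Real.exp (gaussLogRatio ρ p))
      ∂((gaussianReal 0 1).prod (gaussianReal 0 1)) = 1 := by
  have hm := measurable_gaussLogRatio ρ
  rw [lintegral_prod _ (by fun_prop)]
  have : ∀ u : ℝ, ∫⁻ v, ENNReal.ofReal (Real.exp (gaussLogRatio ρ (u, v))) ∂(gaussianReal 0 1)
      = 1 := by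
    intro u
    rw [gaussianReal_of_var_ne_zero _ one_ne_zero,
      lintegral_withDensity_eq_lintegral_mul _ (by fun_prop) (by fun_prop),
      ← lintegral_gaussianPDF_eq_one (ρ * u) (v := Real.toNNReal (1 - ρ^2)) (by simpa using h)]
    refine lintegral_congr fun v => ?_
    simp only [Pi.mul_apply, gaussianPDF]
    rw [← ENNReal.ofReal_mul (gaussianPDFReal_nonneg _ _ _), pdf_mul_exp_gaussLogRatio ρ h]
  simp [this]

lemma gauss_sq : Integrable (fun x : ℝ => x^2) (gaussianReal 0 1) ∧
    ∫ x, x^2 ∂(gaussianReal 0 1) = 1 := by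
  constructor
  · exact (memLp_id_gaussianReal (μ := 0) (v := 1) 2).integrable_sq
  · have := variance_fun_id_gaussianReal (μ := 0) (v := 1)
    rw [variance_of_integral_eq_zero (by fun_prop) (by simp)] at this
    simpa using this

/-- Let `X, Y` be random variables and `U = φ(X)`, `V = ψ(Y)` measurable functions
of `X` and `Y`, each marginally standard normal, with correlation `ρ = E[UV]`.  Then
`I(X;Y) ≥ I(U;V) ≥ −(1/2)·log(1 − ρ²)`. -/
theorem gaussian_lower_bound_univariate
    {Ω : Type*} [MeasureSpace Ω] [IsProbabilityMeasure (ℙ : Measure Ω)]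
    {α β : Type*} [MeasurableSpace α] [MeasurableSpace β]
    (X : Ω → α) (Y : Ω → β) (hX : Measurable X) (hY : Measurable Y)
    (φ : α → ℝ) (ψ : β → ℝ) (hφ : Measurable φ) (hψ : Measurable ψ)
    (hU : Measure.map (fun ω => φ (X ω)) (ℙ : Measure Ω) = gaussianReal 0 1)
    (hV : Measure.map (fun ω => ψ (Y ω)) (ℙ : Measure Ω) = gaussianReal 0 1)
    (hInt : Integrable (fun ω => φ (X ω) * ψ (Y ω)) (ℙ : Measure Ω))
    (ρ : ℝ) (hρ : ρ = ∫ ω, φ (X ω) * ψ (Y ω) ∂(ℙ : Measure Ω)) (hρ1 : |ρ| < 1)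
    -- absolute continuity and integrability ensuring well-defined mutual informations
    (hacXY : Measure.map (fun ω => (X ω, Y ω)) (ℙ : Measure Ω)
      ≪ (Measure.map X (ℙ : Measure Ω)).prod (Measure.map Y (ℙ : Measure Ω)))
    (hIntXY : Integrable (fun p => Real.log
        (((Measure.map (fun ω => (X ω, Y ω)) (ℙ : Measure Ω)).rnDeriv
          ((Measure.map X (ℙ : Measure Ω)).prod (Measure.map Y (ℙ : Measure Ω))) p).toReal))
      (Measure.map (fun ω => (X ω, Y ω)) (ℙ : Measure Ω))) :
    mutualInfo X Y ≥ mutualInfo (fun ω => φ (X ω)) (fun ω => ψ (Y ω))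
      ∧ mutualInfo (fun ω => φ (X ω)) (fun ω => ψ (Y ω)) ≥ -(1/2) * Real.log (1 - ρ^2) := by
  have hUm : Measurable (fun ω => φ (X ω)) := hφ.comp hX
  have hVm : Measurable (fun ω => ψ (Y ω)) := hψ.comp hY
  have hg : Measurable (Prod.map φ ψ) := hφ.prodMap hψ
  have hXY : Measurable (fun ω => (X ω, Y ω)) := hX.prodMk hY
  have : IsProbabilityMeasure (Measure.map X (ℙ : Measure Ω)) :=
    Measure.isProbabilityMeasure_map hX.aemeasurable
  have : IsProbabilityMeasure (Measure.map Y (ℙ : Measure Ω)) :=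
    Measure.isProbabilityMeasure_map hY.aemeasurable
  have : IsProbabilityMeasure (Measure.map (fun ω => (X ω, Y ω)) (ℙ : Measure Ω)) :=
    Measure.isProbabilityMeasure_map hXY.aemeasurable
  have hμ : Measure.map (fun ω => (φ (X ω), ψ (Y ω))) (ℙ : Measure Ω)
      = (Measure.map (fun ω => (X ω, Y ω)) (ℙ : Measure Ω)).map (Prod.map φ ψ) := by
    rw [Measure.map_map hg hXY]; rfl
  have hν : (Measure.map (fun ω => φ (X ω)) (ℙ : Measure Ω)).prod
      (Measure.map (fun ω => ψ (Y ω)) (ℙ : Measure Ω))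
      = ((Measure.map X (ℙ : Measure Ω)).prod (Measure.map Y (ℙ : Measure Ω))).map
        (Prod.map φ ψ) := by
    rw [← Measure.map_prod_map _ _ hφ hψ, Measure.map_map hφ hX, Measure.map_map hψ hY]; rfl
  have hUVm : Measurable (fun ω => (φ (X ω), ψ (Y ω))) := hUm.prodMk hVm
  have : IsProbabilityMeasure (Measure.map (fun ω => (φ (X ω), ψ (Y ω))) (ℙ : Measure Ω)) :=
    Measure.isProbabilityMeasure_map hUVm.aemeasurable
  have hac := hacXY.map hg
  have hint := InformationTheory.integrable_llr_map hacXY hg hIntXY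
  have hle := InformationTheory.klDiv_map_le
    (Measure.map (fun ω => (X ω, Y ω)) (ℙ : Measure Ω))
    ((Measure.map X (ℙ : Measure Ω)).prod (Measure.map Y (ℙ : Measure Ω))) hg
  have hle' := ENNReal.toReal_mono (InformationTheory.klDiv_ne_top hacXY hIntXY) hle
  rw [← hμ, ← hν] at hac hint hle'
  rw [hU, hV] at hac hint hle'
  rw [InformationTheory.toReal_klDiv_of_measure_eq hac (by simp),
    InformationTheory.toReal_klDiv_of_measure_eq hacXY (by simp)] at hle'
  have e : mutualInfo (fun ω => φ (X ω)) (fun ω => ψ (Y ω)) =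
      ∫ a, llr (Measure.map (fun ω => (φ (X ω), ψ (Y ω))) (ℙ : Measure Ω))
        ((gaussianReal 0 1).prod (gaussianReal 0 1)) a
        ∂(Measure.map (fun ω => (φ (X ω), ψ (Y ω))) (ℙ : Measure Ω)) := by
    unfold mutualInfo klDiv
    rw [hU, hV]; rfl
  refine ⟨by rw [e]; exact hle', ?_⟩
  rw [e]
  have hpos : 0 < 1 - ρ^2 := by
    have := (sq_lt_one_iff_abs_lt_one ρ).2 hρ1
    linarith
  have hfm := measurable_gaussLogRatio ρ
  have hl := lintegral_exp_gaussLogRatio ρ hpos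
  have hexp : Integrable (fun p => Real.exp (gaussLogRatio ρ p))
      ((gaussianReal 0 1).prod (gaussianReal 0 1)) := by
    refine ⟨by fun_prop, ?_⟩
    rw [hasFiniteIntegral_iff_ofReal (Filter.Eventually.of_forall fun p => (Real.exp_pos _).le), hl]
    simp
  have hexp1 : ∫ p, Real.exp (gaussLogRatio ρ p)
      ∂((gaussianReal 0 1).prod (gaussianReal 0 1)) = 1 := by
    rw [integral_eq_lintegral_of_nonneg_ae
      (Filter.Eventually.of_forall fun p => (Real.exp_pos _).le) (by fun_prop), hl]
    simp
  obtain ⟨hsq, hsq1⟩ := gauss_sq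
  have hu2 : Integrable (fun ω => φ (X ω) ^ 2) (ℙ : Measure Ω) := by
    rw [← hU] at hsq
    exact hsq.comp_measurable hUm
  have hv2 : Integrable (fun ω => ψ (Y ω) ^ 2) (ℙ : Measure Ω) := by
    rw [← hV] at hsq
    exact hsq.comp_measurable hVm
  have iu2 : ∫ ω, φ (X ω) ^ 2 ∂(ℙ : Measure Ω) = 1 := by
    rw [← hsq1, ← hU, integral_map hUm.aemeasurable (by fun_prop)]
  have iv2 : ∫ ω, ψ (Y ω) ^ 2 ∂(ℙ : Measure Ω) = 1 := by
    rw [← hsq1, ← hV, integral_map hVm.aemeasurable (by fun_prop)]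
  have i1 : Integrable (fun ω => ρ^2 * φ (X ω) ^ 2 - 2 * ρ * (φ (X ω) * ψ (Y ω)))
      (ℙ : Measure Ω) := (hu2.const_mul (ρ^2)).sub (hInt.const_mul (2 * ρ))
  have i2 : Integrable (fun ω => (ρ^2 * φ (X ω) ^ 2 - 2 * ρ * (φ (X ω) * ψ (Y ω))
      + ρ^2 * ψ (Y ω) ^ 2) / (2 * (1 - ρ^2))) (ℙ : Measure Ω) := (i1.add (hv2.const_mul (ρ^2))).div_const (2 * (1 - ρ^2))
  have hfΩ : Integrable (fun ω => gaussLogRatio ρ (φ (X ω), ψ (Y ω))) (ℙ : Measure Ω) :=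
    (integrable_const (-(1/2) * Real.log (1 - ρ^2))).sub i2
  have hf : Integrable (gaussLogRatio ρ)
      (Measure.map (fun ω => (φ (X ω), ψ (Y ω))) (ℙ : Measure Ω)) :=
    (integrable_map_measure hfm.aestronglyMeasurable hUVm.aemeasurable).2 hfΩ
  have hfi : ∫ p, gaussLogRatio ρ p
      ∂(Measure.map (fun ω => (φ (X ω), ψ (Y ω))) (ℙ : Measure Ω))
      = -(1/2) * Real.log (1 - ρ^2) := by
    rw [integral_map hUVm.aemeasurable hfm.aestronglyMeasurable]
    have e1 : ∫ ω, gaussLogRatio ρ (φ (X ω), ψ (Y ω)) ∂(ℙ : Measure Ω)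
        = ∫ ω, (-(1/2) * Real.log (1 - ρ^2)) ∂(ℙ : Measure Ω)
          - (∫ ω, ρ^2 * φ (X ω) ^ 2 ∂(ℙ : Measure Ω)
            - ∫ ω, 2 * ρ * (φ (X ω) * ψ (Y ω)) ∂(ℙ : Measure Ω)
            + ∫ ω, ρ^2 * ψ (Y ω) ^ 2 ∂(ℙ : Measure Ω)) / (2 * (1 - ρ^2)) := by
      rw [← integral_sub (hu2.const_mul (ρ^2)) (hInt.const_mul (2 * ρ)),
        ← integral_add i1 (hv2.const_mul (ρ^2)), ← integral_div,
        ← integral_sub (integrable_const _) i2]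
      rfl
    rw [e1]
    simp only [integral_const_mul, iu2, iv2, ← hρ]
    simp
    left
    ring
  have hac2 := hac.trans (absolutelyContinuous_tilted hexp)
  have := isProbabilityMeasure_tilted hexp
  have hnn := InformationTheory.toReal_klDiv_of_measure_eq hac2 (by simp)
  rw [integral_llr_tilted_right hac hf hexp hint, hfi, hexp1, Real.log_one, add_zero] at hnn
  have h0 : 0 ≤ (InformationTheory.klDiv (Measure.map (fun ω => (φ (X ω), ψ (Y ω))) (ℙ : Measure Ω))
    (((gaussianReal 0 1).prod (gaussianReal 0 1)).tilted (gaussLogRatio ρ))).toReal :=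
    ENNReal.toReal_nonneg
  rw [hnn] at h0
  linarith
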